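/- arXiv:1808.03750 — 5 statements merged into one kernel-verified Lean document; each statement's English description precedes it below -/
import Mathlib

section
/- Let μ be a σ-finite measure on ℝ and let I ⊆ ℝ be a nonempty open interval. Let u : ℝ → ℝ be measurable such that for every θ ∈ I the function y ↦ exp(θ y) · u(y) is μ-integrable and ∫_ℝ exp(θ y) u(y) dμ(y) = 0. Then u = 0 μ-almost everywhere. -/
open MeasureTheory Real

open ProbabilityTheory Filter Topology

/-- Two measures on `ℝ` whose moment-generating functions are finite and agree in a neighborhood
of `0` are equal. -/
theorem MeasureTheory.Measure.ext_of_mgf_eventuallyEq {ν ν' : Measure ℝ}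
    (hν : 0 ∈ interior (integrableExpSet id ν)) (hν' : 0 ∈ interior (integrableExpSet id ν'))
    (h : mgf id ν =ᶠ[𝓝 0] mgf id ν') : ν = ν' := by
  have finite_of_mem {ρ : Measure ℝ} (hρ : 0 ∈ interior (integrableExpSet id ρ)) :
      IsFiniteMeasure ρ := by
    have h_one := interior_subset hρ
    simp only [integrableExpSet, Set.mem_ofPred_eq, zero_mul, Real.exp_zero] at h_one
    exact (integrable_const_iff_isFiniteMeasure one_ne_zero).mp h_one
  have := finite_of_mem hν
  have := finite_of_mem hν'
  set S : Set ℝ := interior (integrableExpSet id ν) ∩ interior (integrableExpSet id ν')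
  have h_strip : Set.EqOn (complexMGF id ν) (complexMGF id ν') {z | z.re ∈ S} := by
    refine AnalyticOnNhd.eqOn_of_preconnected_of_frequently_eq
      (analyticOnNhd_complexMGF.mono fun z hz ↦ hz.1)
      (analyticOnNhd_complexMGF.mono fun z hz ↦ hz.2)
      ((convex_integrableExpSet.interior.inter convex_integrableExpSet.interior).linear_preimage
        Complex.reLm).isPreconnected
      (z₀ := ((0 : ℝ) : ℂ)) ⟨hν, hν'⟩ ?_
    have h_tendsto : Tendsto ((↑) : ℝ → ℂ) (𝓝[≠] 0) (𝓝[≠] ((0 : ℝ) : ℂ)) :=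
      Complex.continuous_ofReal.continuousAt.continuousWithinAt.tendsto_nhdsWithin
        fun x hx ↦ by simpa using hx
    refine h_tendsto.frequently (Eventually.frequently ?_)
    filter_upwards [h.filter_mono nhdsWithin_le_nhds] with x hx
    rw [complexMGF_ofReal, complexMGF_ofReal, hx]
  refine Measure.ext_of_charFun (funext fun t ↦ ?_)
  rw [← complexMGF_id_mul_I, ← complexMGF_id_mul_I]
  exact h_strip (by simpa using ⟨hν, hν'⟩)

/-- The moment-generating function of the measure whose density is the positive part of `v`. -/
theorem mgf_id_withDensity_ofReal {μ : Measure ℝ} {v : ℝ → ℝ} (hv : Measurable v) (t : ℝ) :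
    mgf id (μ.withDensity fun y ↦ ENNReal.ofReal (v y)) t
      = ∫ y, max (Real.exp (t * y) * v y) 0 ∂μ := by
  rw [mgf, integral_withDensity_eq_integral_toReal_smul₀ (by fun_prop) (by simp)]
  refine integral_congr_ae (ae_of_all _ fun y ↦ ?_)
  simp [ENNReal.toReal_ofReal', max_mul_of_nonneg, Real.exp_nonneg, mul_comm (v y)]

theorem mem_integrableExpSet_id_withDensity_ofReal {μ : Measure ℝ} {v : ℝ → ℝ}
    (hv : Measurable v) {t : ℝ} (ht : Integrable (fun y ↦ Real.exp (t * y) * v y) μ) :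
    t ∈ integrableExpSet id (μ.withDensity fun y ↦ ENNReal.ofReal (v y)) := by
  refine (integrable_withDensity_iff (by fun_prop) (by simp)).mpr (ht.pos_part.congr ?_)
  refine ae_of_all _ fun y ↦ ?_
  simp [ENNReal.toReal_ofReal', mul_max_of_nonneg, Real.exp_nonneg]

/-- A function whose two-sided Laplace transform exists and vanishes in a neighborhood of `0` is
almost everywhere zero. -/
theorem ae_eq_zero_of_eventually_integral_exp_mul_eq_zero {μ : Measure ℝ} [SigmaFinite μ]
    {v : ℝ → ℝ} (hv : Measurable v)
    (h : ∀ᶠ t in 𝓝 (0 : ℝ), Integrable (fun y ↦ Real.exp (t * y) * v y) μ ∧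
      ∫ y, Real.exp (t * y) * v y ∂μ = 0) :
    v =ᵐ[μ] 0 := by
  have h_eq : μ.withDensity (fun y ↦ ENNReal.ofReal (v y))
      = μ.withDensity (fun y ↦ ENNReal.ofReal (-v y)) := by
    refine Measure.ext_of_mgf_eventuallyEq ?_ ?_ ?_
    · rw [mem_interior_iff_mem_nhds]
      filter_upwards [h] with t ht
      exact mem_integrableExpSet_id_withDensity_ofReal hv ht.1
    · rw [mem_interior_iff_mem_nhds]
      filter_upwards [h] with t ht
      exact mem_integrableExpSet_id_withDensity_ofReal hv.neg (by simpa using ht.1.neg)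
    · filter_upwards [h] with t ⟨ht_int, ht_zero⟩
      rw [mgf_id_withDensity_ofReal hv, mgf_id_withDensity_ofReal (by fun_prop), ← sub_eq_zero]
      simp only [mul_neg]
      rw [← integral_sub ht_int.pos_part ht_int.neg_part]
      simpa only [max_zero_sub_eq_self] using ht_zero
  filter_upwards [(withDensity_eq_iff_of_sigmaFinite (by fun_prop) (by fun_prop)).mp h_eq]
    with y hy
  have h_max := congrArg ENNReal.toReal hy
  rw [ENNReal.toReal_ofReal', ENNReal.toReal_ofReal'] at h_max
  have h_sub : max (v y) 0 - max (-v y) 0 = v y := max_zero_sub_eq_self _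
  rw [Pi.zero_apply, ← h_sub, h_max, sub_self]

/-- Completeness of the one-parameter exponential family (Lehmann's completeness theorem):
if `∫ exp (θ y) u y ∂μ = 0` for all `θ` in a nonempty open interval `I`, with the integrand
integrable, then `u = 0` μ-almost everywhere. -/
theorem exponential_family_completeness
    (μ : Measure ℝ) [SigmaFinite μ]
    (I : Set ℝ) (hI_open : IsOpen I) (hI_ne : I.Nonempty) (hI_conn : I.OrdConnected)
    (u : ℝ → ℝ) (hu : Measurable u)
    (h : ∀ θ ∈ I, Integrable (fun y : ℝ => Real.exp (θ * y) * u y) μ ∧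
      ∫ y : ℝ, Real.exp (θ * y) * u y ∂μ = 0) :
    u =ᵐ[μ] 0 := by
  obtain ⟨θ₀, hθ₀⟩ := hI_ne
  have h_tilt : (fun y ↦ Real.exp (θ₀ * y) * u y) =ᵐ[μ] 0 := by
    refine ae_eq_zero_of_eventually_integral_exp_mul_eq_zero (by fun_prop) ?_
    have h_mem : ∀ᶠ t in 𝓝 (0 : ℝ), t + θ₀ ∈ I :=
      (by fun_prop : Continuous fun t : ℝ ↦ t + θ₀).continuousAt.eventually_mem
        (hI_open.mem_nhds (by simpa using hθ₀))
    filter_upwards [h_mem] with t ht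
    simpa only [add_mul, Real.exp_add, mul_assoc] using h (t + θ₀) ht
  filter_upwards [h_tilt] with y hy
  simpa [Real.exp_ne_zero] using hy
end

section
/- Let d ≥ 1 and let I ⊆ ℝ be a nonempty open interval. Let q : ℝ × ℝ^d → ℝ be measurable with q(y₀, x) > 0 for all (y₀, x), and let k̄ : ℝ → ℝ and κ : ℝ^d → ℝ be measurable. For θ ∈ I define the weight w_θ(y₀, x) := exp(θ y₀ + k̄(y₀) + κ(x)) · q(y₀, x). Suppose p, p̃ : ℝ × ℝ × ℝ^d → ℝ are measurable and that for every θ ∈ I and every (y₁, x) ∈ ℝ × ℝ^d the functions y₀ ↦ p(y₁, y₀, x) · w_θ(y₀, x) and y₀ ↦ p̃(y₁, y₀, x) · w_θ(y₀, x) are Lebesgue-integrable with ∫_ℝ p(y₁, y₀, x) w_θ(y₀, x) dy₀ = ∫_ℝ p̃(y₁, y₀, x) w_θ(y₀, x) dy₀. Then for every (y₁, x), p(y₁, ·, x) = p̃(y₁, ·, x) Lebesgue-almost everywhere. -/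
open MeasureTheory Real

section

open ProbabilityTheory

/-- Finite measures on `ℝ` whose moment-generating functions are finite and equal near `0`
coincide. -/
lemma measure_ext_of_mgf_eqOn_Ioo {μ ν : Measure ℝ} [IsFiniteMeasure μ] [IsFiniteMeasure ν]
    {ε : ℝ} (hε : 0 < ε) (hμ : Set.Ioo (-ε) ε ⊆ integrableExpSet id μ)
    (hν : Set.Ioo (-ε) ε ⊆ integrableExpSet id ν)
    (h : Set.EqOn (mgf id μ) (mgf id ν) (Set.Ioo (-ε) ε)) : μ = ν := by
  have hstrip : IsPreconnected {z : ℂ | z.re ∈ Set.Ioo (-ε) ε} :=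
    ((convex_Ioo (-ε) ε).linear_preimage Complex.reLm).isPreconnected
  have hsub {ρ : Measure ℝ} (hρ : Set.Ioo (-ε) ε ⊆ integrableExpSet id ρ) :
      AnalyticOnNhd ℂ (complexMGF id ρ) {z : ℂ | z.re ∈ Set.Ioo (-ε) ε} :=
    analyticOnNhd_complexMGF.mono fun z hz ↦ interior_maximal hρ isOpen_Ioo hz
  have h0 : (0 : ℂ) ∈ {z : ℂ | z.re ∈ Set.Ioo (-ε) ε} := by simp [hε]
  have heq : Set.EqOn (complexMGF id μ) (complexMGF id ν) {z : ℂ | z.re ∈ Set.Ioo (-ε) ε} := by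
    refine (hsub hμ).eqOn_of_preconnected_of_frequently_eq (hsub hν) hstrip h0 ?_
    have h_real : ∃ᶠ x : ℝ in nhdsWithin 0 {0}ᶜ, complexMGF id μ x = complexMGF id ν x := by
      refine Filter.Eventually.frequently (nhdsWithin_le_nhds ?_)
      filter_upwards [Ioo_mem_nhds (neg_lt_zero.mpr hε) hε] with x hx
      rw [complexMGF_ofReal, complexMGF_ofReal, h hx]
    refine Filter.Tendsto.frequently (f := fun x : ℝ ↦ (x : ℂ)) ?_ h_real
    refine tendsto_nhdsWithin_iff.mpr ⟨?_, ?_⟩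
    · exact (Complex.continuous_ofReal.tendsto' 0 0 (by simp)).mono_left nhdsWithin_le_nhds
    · filter_upwards [self_mem_nhdsWithin] with x hx
      simpa using hx
  refine Measure.ext_of_charFun (funext fun t ↦ ?_)
  rw [← complexMGF_id_mul_I, ← complexMGF_id_mul_I]
  exact heq (by simp [hε])

/-- Completeness of the one-parameter exponential family: a function whose Laplace transform
vanishes near `0` is almost everywhere zero. -/
lemma ae_eq_zero_of_integral_exp_mul_eq_zero {μ : Measure ℝ} [SigmaFinite μ] {f : ℝ → ℝ}
    (hf : Measurable f) {ε : ℝ} (hε : 0 < ε)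
    (hint : ∀ t ∈ Set.Ioo (-ε) ε, Integrable (fun y ↦ exp (t * y) * f y) μ)
    (hzero : ∀ t ∈ Set.Ioo (-ε) ε, ∫ y, exp (t * y) * f y ∂μ = 0) : f =ᵐ[μ] 0 := by
  have hf_neg : Measurable fun y ↦ -f y := hf.neg
  have hf_int : Integrable f μ := by simpa using hint 0 (by simp [hε])
  have hpos (t : ℝ) (ht : t ∈ Set.Ioo (-ε) ε) :
      Integrable (fun y ↦ max (f y) 0 * exp (t * y)) μ := by
    refine (hint t ht).pos_part.congr (.of_forall fun y ↦ ?_)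
    simp [max_mul_of_nonneg _ _ (exp_pos (t * y)).le, mul_comm]
  have hneg (t : ℝ) (ht : t ∈ Set.Ioo (-ε) ε) :
      Integrable (fun y ↦ max (-f y) 0 * exp (t * y)) μ := by
    refine (hint t ht).neg_part.congr (.of_forall fun y ↦ ?_)
    simp [max_mul_of_nonneg _ _ (exp_pos (t * y)).le, mul_comm]
  have hexp {g : ℝ → ℝ} (hg : Measurable g)
      (h : ∀ t ∈ Set.Ioo (-ε) ε, Integrable (fun y ↦ max (g y) 0 * exp (t * y)) μ) :
      Set.Ioo (-ε) ε ⊆ integrableExpSet id (μ.withDensity fun y ↦ ENNReal.ofReal (g y)) := by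
    intro t ht
    refine (integrable_withDensity_iff_integrable_smul' hg.ennreal_ofReal (by simp)).mpr ?_
    simpa [ENNReal.toReal_ofReal'] using h t ht
  have hmgf {g : ℝ → ℝ} (hg : Measurable g) (t : ℝ) :
      mgf id (μ.withDensity fun y ↦ ENNReal.ofReal (g y)) t
        = ∫ y, max (g y) 0 * exp (t * y) ∂μ := by
    rw [mgf, integral_withDensity_eq_integral_toReal_smul hg.ennreal_ofReal (by simp)]
    simp [ENNReal.toReal_ofReal']
  have := isFiniteMeasure_withDensity_ofReal hf_int.2
  have := isFiniteMeasure_withDensity_ofReal (f := fun y ↦ -f y) hf_int.neg.2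
  have heq : μ.withDensity (fun y ↦ ENNReal.ofReal (f y))
      = μ.withDensity (fun y ↦ ENNReal.ofReal (-f y)) := by
    refine measure_ext_of_mgf_eqOn_Ioo hε (hexp hf hpos) (hexp hf_neg hneg) fun t ht ↦ ?_
    rw [hmgf hf, hmgf hf_neg, ← sub_eq_zero]
    refine (integral_sub (hpos t ht) (hneg t ht)).symm.trans (.trans ?_ (hzero t ht))
    congr with y
    rw [← sub_mul, max_zero_sub_max_neg_zero_eq_self, mul_comm]
  rw [withDensity_eq_iff_of_sigmaFinite hf.ennreal_ofReal.aemeasurable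
    hf_neg.ennreal_ofReal.aemeasurable] at heq
  filter_upwards [heq] with y hy
  have h := congrArg ENNReal.toReal hy
  simp only [ENNReal.toReal_ofReal'] at h
  rw [Pi.zero_apply]
  grind

end

/-- Uniqueness content of Theorem 2: if two candidate conditional densities `p` and `ptilde`
produce the same integrals against the exponential-family weights
`w_θ(y₀, x) = exp (θ y₀ + k̄ y₀ + κ x) * q (y₀, x)` for every `θ` in a nonempty open
interval, then they agree Lebesgue-almost everywhere in `y₀` for each fixed `(y₁, x)`. -/
theorem fredholm_uniqueness_under_completeness
    (d : ℕ) (hd : 1 ≤ d)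
    (I : Set ℝ) (hI_open : IsOpen I) (hI_ne : I.Nonempty) (hI_conn : I.OrdConnected)
    (q : ℝ × (Fin d → ℝ) → ℝ) (hq_meas : Measurable q) (hq_pos : ∀ p, 0 < q p)
    (kbar : ℝ → ℝ) (hkbar : Measurable kbar)
    (κ : (Fin d → ℝ) → ℝ) (hκ : Measurable κ)
    (p ptilde : ℝ × ℝ × (Fin d → ℝ) → ℝ) (hp : Measurable p) (hptilde : Measurable ptilde)
    (h : ∀ θ ∈ I, ∀ (y₁ : ℝ) (x : Fin d → ℝ),
      Integrable (fun y₀ : ℝ =>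
        p (y₁, y₀, x) * (Real.exp (θ * y₀ + kbar y₀ + κ x) * q (y₀, x))) ∧
      Integrable (fun y₀ : ℝ =>
        ptilde (y₁, y₀, x) * (Real.exp (θ * y₀ + kbar y₀ + κ x) * q (y₀, x))) ∧
      ∫ y₀ : ℝ, p (y₁, y₀, x) * (Real.exp (θ * y₀ + kbar y₀ + κ x) * q (y₀, x)) =
        ∫ y₀ : ℝ, ptilde (y₁, y₀, x) * (Real.exp (θ * y₀ + kbar y₀ + κ x) * q (y₀, x))) :
    ∀ (y₁ : ℝ) (x : Fin d → ℝ),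
      (fun y₀ : ℝ => p (y₁, y₀, x)) =ᵐ[volume] (fun y₀ : ℝ => ptilde (y₁, y₀, x)) := by
  intro y₁ x
  obtain ⟨θ₀, hθ₀⟩ := hI_ne
  obtain ⟨ε, hε, hball⟩ := Metric.isOpen_iff.mp hI_open θ₀ hθ₀
  have hmem (t : ℝ) (ht : t ∈ Set.Ioo (-ε) ε) : θ₀ + t ∈ I :=
    hball (by simpa [Real.dist_eq, abs_lt] using ht)
  have hrw (t : ℝ) :
      (fun y ↦ exp (t * y) *
        ((p (y₁, y, x) - ptilde (y₁, y, x)) * (exp (θ₀ * y + kbar y + κ x) * q (y, x))))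
      = fun y ↦ p (y₁, y, x) * (exp ((θ₀ + t) * y + kbar y + κ x) * q (y, x))
        - ptilde (y₁, y, x) * (exp ((θ₀ + t) * y + kbar y + κ x) * q (y, x)) := by
    funext y
    rw [show (θ₀ + t) * y + kbar y + κ x = t * y + (θ₀ * y + kbar y + κ x) by ring,
      exp_add (t * y)]
    ring
  have hzero := ae_eq_zero_of_integral_exp_mul_eq_zero (μ := volume)
    (f := fun y ↦ (p (y₁, y, x) - ptilde (y₁, y, x)) * (exp (θ₀ * y + kbar y + κ x) * q (y, x)))
    (by fun_prop) hε
    (fun t ht ↦ by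
      obtain ⟨h₁, h₂, -⟩ := h _ (hmem t ht) y₁ x
      rw [hrw]
      exact h₁.sub h₂)
    (fun t ht ↦ by
      obtain ⟨h₁, h₂, h₃⟩ := h _ (hmem t ht) y₁ x
      rw [hrw, integral_sub h₁ h₂, h₃, sub_self])
  filter_upwards [hzero] with y hy
  have hw : exp (θ₀ * y + kbar y + κ x) * q (y, x) ≠ 0 :=
    (mul_pos (exp_pos _) (hq_pos _)).ne'
  exact sub_eq_zero.mp ((mul_eq_zero.mp hy).resolve_right hw)
end

section
/- Let (Ω, 𝓕, P) be a probability space carrying random variables R : Ω → {0,1} (random assignment), Z* : Ω → {0,1} (compliance with treatment if assigned), and integrable Y₀, Y₁ : Ω → ℝ (potential outcomes). Assume R is independent of the triple (Z*, Y₀, Y₁), 0 < P(R = 1) < 1, and P(Z* = 1) > 0. Define the realized treatment Z := R · Z* (one-sided noncompliance: Z = 0 whenever R = 0) and the observed outcome Y := Z · Y₁ + (1 − Z) · Y₀. Then P(Z = 1 | R = 1) = P(Z* = 1) > 0 and (E[Y | R = 1] − E[Y | R = 0]) / P(Z = 1 | R = 1) = E[Y₁ − Y₀ | Z* = 1] =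 E[Y₁ − Y₀ | Z = 1]. -/
open MeasureTheory ProbabilityTheory

theorem integral_cond_preimage_of_indepFun {Ω β : Type*} [MeasurableSpace Ω]
    [MeasurableSpace β] {P : Measure Ω} [IsFiniteMeasure P] {R : Ω → β} {X : Ω → ℝ} {s : Set β}
    (hR : Measurable R) (hX : AEStronglyMeasurable X P) (hind : IndepFun R X P)
    (hs : MeasurableSet s) (hpos : P (R ⁻¹' s) ≠ 0) :
    ∫ ω, X ω ∂P[|R ⁻¹' s] = ∫ ω, X ω ∂P := by
  have hind' : IndepFun (fun ω => s.indicator (fun _ => (1 : ℝ)) (R ω)) X P :=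
    hind.comp (φ := s.indicator fun _ => (1 : ℝ)) (ψ := id)
      (measurable_const.indicator hs) measurable_id
  have hmul := hind'.integral_fun_mul_eq_mul_integral
    ((measurable_const.indicator hs).comp hR).aestronglyMeasurable hX
  have hset : ∫ ω, s.indicator (fun _ => (1 : ℝ)) (R ω) * X ω ∂P = ∫ ω in R ⁻¹' s, X ω ∂P := by
    rw [← integral_indicator (hR hs)]
    congr 1 with ω
    by_cases h : R ω ∈ s <;> simp [h]
  have hprob : ∫ ω, s.indicator (fun _ => (1 : ℝ)) (R ω) ∂P = P.real (R ⁻¹' s) := by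
    rw [← integral_indicator_one (hR hs)]
    rfl
  have hreal : P.real (R ⁻¹' s) ≠ 0 := by
    simpa [Measure.real, ENNReal.toReal_eq_zero_iff] using hpos
  rw [ProbabilityTheory.cond, integral_smul_measure, ← hset, hmul, hprob, ENNReal.toReal_inv,
    smul_eq_mul]
  exact inv_mul_cancel_left₀ hreal _

theorem integral_cond_eq_integral_mul_div {Ω : Type*} [MeasurableSpace Ω] (μ : Measure Ω)
    {Z : Ω → ℝ} (hZ : Measurable Z) (hZ01 : ∀ ω, Z ω = 0 ∨ Z ω = 1) (X : Ω → ℝ) :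
    ∫ ω, X ω ∂μ[|{ω | Z ω = 1}] = (∫ ω, Z ω * X ω ∂μ) / (μ {ω | Z ω = 1}).toReal := by
  have hset : ∫ ω, Z ω * X ω ∂μ = ∫ ω in {ω | Z ω = 1}, X ω ∂μ := by
    have hmeas : MeasurableSet {ω | Z ω = 1} := hZ (measurableSet_singleton 1)
    rw [← integral_indicator hmeas]
    congr 1 with ω
    rcases hZ01 ω with h | h <;> simp [Set.indicator, h]
  rw [ProbabilityTheory.cond, integral_smul_measure, hset, ENNReal.toReal_inv, smul_eq_mul,
    inv_mul_eq_div]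

/-- In an RCT with one-sided noncompliance (`Z = R · Z*`, observed outcome
`Y = Z·Y₁ + (1−Z)·Y₀`, assignment `R` independent of `(Z*, Y₀, Y₁)`), the Wald (IV) estimand
`(E[Y | R=1] − E[Y | R=0]) / P(Z=1 | R=1)` equals the average treatment effect on the
treated `E[Y₁ − Y₀ | Z* = 1] = E[Y₁ − Y₀ | Z = 1]`, and `P(Z=1 | R=1) = P(Z*=1) > 0`. -/
theorem late_equals_att_one_sided_noncompliance
    {Ω : Type*} [MeasurableSpace Ω] (P : Measure Ω) [IsProbabilityMeasure P]
    (R Zs Y₀ Y₁ : Ω → ℝ)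
    (hR : Measurable R) (hZs : Measurable Zs)
    (hR01 : ∀ ω, R ω = 0 ∨ R ω = 1) (hZs01 : ∀ ω, Zs ω = 0 ∨ Zs ω = 1)
    (hY₀ : Integrable Y₀ P) (hY₁ : Integrable Y₁ P)
    (hindep : IndepFun R (fun ω => (Zs ω, Y₀ ω, Y₁ ω)) P)
    (hR1_pos : 0 < P {ω | R ω = 1}) (hR1_lt : P {ω | R ω = 1} < 1)
    (hZs1_pos : 0 < P {ω | Zs ω = 1}) :
    P[|{ω | R ω = 1}] {ω | R ω * Zs ω = 1} = P {ω | Zs ω = 1} ∧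
    0 < P[|{ω | R ω = 1}] {ω | R ω * Zs ω = 1} ∧
    ((∫ ω, (R ω * Zs ω * Y₁ ω + (1 - R ω * Zs ω) * Y₀ ω) ∂P[|{ω | R ω = 1}]) -
        ∫ ω, (R ω * Zs ω * Y₁ ω + (1 - R ω * Zs ω) * Y₀ ω) ∂P[|{ω | R ω = 0}]) /
        (P[|{ω | R ω = 1}] {ω | R ω * Zs ω = 1}).toReal =
      ∫ ω, (Y₁ ω - Y₀ ω) ∂P[|{ω | Zs ω = 1}] ∧
    (∫ ω, (Y₁ ω - Y₀ ω) ∂P[|{ω | Zs ω = 1}]) =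
      ∫ ω, (Y₁ ω - Y₀ ω) ∂P[|{ω | R ω * Zs ω = 1}] := by
  have hA : MeasurableSet {ω | R ω = 1} := hR (measurableSet_singleton 1)
  have hB : MeasurableSet {ω | Zs ω = 1} := hZs (measurableSet_singleton 1)
  have hA0 : P {ω | R ω = 0} ≠ 0 := by
    have hcompl : {ω | R ω = 0} = {ω | R ω = 1}ᶜ := by
      ext ω
      rcases hR01 ω with h | h <;> simp [h]
    rw [hcompl, prob_compl_eq_one_sub hA]
    exact (tsub_pos_of_lt hR1_lt).ne'
  have hZset : {ω | R ω * Zs ω = 1} = {ω | R ω = 1} ∩ {ω | Zs ω = 1} := by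
    ext ω
    rcases hR01 ω with h | h <;> simp [h]
  have hcondZs : P[|{ω | R ω = 1}] {ω | Zs ω = 1} = P {ω | Zs ω = 1} := by
    have hinter := hindep.measure_inter_preimage_eq_mul {1} (Prod.fst ⁻¹' {1})
      (measurableSet_singleton 1) (measurable_fst (measurableSet_singleton 1))
    rw [cond_apply hA]
    change _ * P (R ⁻¹' {1} ∩ (fun ω => (Zs ω, Y₀ ω, Y₁ ω)) ⁻¹' (Prod.fst ⁻¹' {1})) = _
    rw [hinter, ← mul_assoc]
    change (P {ω | R ω = 1})⁻¹ * P {ω | R ω = 1} * P {ω | Zs ω = 1} = _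
    rw [ENNReal.inv_mul_cancel hR1_pos.ne' (measure_ne_top _ _), one_mul]
  have hcondZ : P[|{ω | R ω = 1}] {ω | R ω * Zs ω = 1} = P {ω | Zs ω = 1} := by
    rw [hZset, cond_inter_self hA, hcondZs]
  have hdiff : Integrable (fun ω => Zs ω * (Y₁ ω - Y₀ ω)) P := by
    refine (hY₁.sub hY₀).bdd_mul (c := 1) hZs.aestronglyMeasurable (.of_forall fun ω => ?_)
    rcases hZs01 ω with h | h <;> simp [h]
  have hassigned_int : Integrable (fun ω => Zs ω * (Y₁ ω - Y₀ ω) + Y₀ ω) P := hdiff.add hY₀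
  have hindep_diff : IndepFun R (fun ω => Zs ω * (Y₁ ω - Y₀ ω)) P :=
    hindep.comp (φ := id) (ψ := fun p : ℝ × ℝ × ℝ => p.1 * (p.2.2 - p.2.1))
      measurable_id (by fun_prop)
  have hindep_assigned : IndepFun R (fun ω => Zs ω * (Y₁ ω - Y₀ ω) + Y₀ ω) P :=
    hindep.comp (φ := id) (ψ := fun p : ℝ × ℝ × ℝ => p.1 * (p.2.2 - p.2.1) + p.2.1)
      measurable_id (by fun_prop)
  have hindep_Y₀ : IndepFun R Y₀ P :=
    hindep.comp (φ := id) (ψ := fun p : ℝ × ℝ × ℝ => p.2.1) measurable_id (by fun_prop)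
  have hassigned : ∫ ω, (R ω * Zs ω * Y₁ ω + (1 - R ω * Zs ω) * Y₀ ω) ∂P[|{ω | R ω = 1}] =
      ∫ ω, (Zs ω * (Y₁ ω - Y₀ ω) + Y₀ ω) ∂P := by
    refine Eq.trans (integral_congr_ae ?_)
      (integral_cond_preimage_of_indepFun hR hassigned_int.aestronglyMeasurable
        hindep_assigned (measurableSet_singleton 1) hR1_pos.ne')
    filter_upwards [ae_cond_mem hA] with ω hω
    rw [show R ω = 1 from hω]
    ring
  have hunassigned : ∫ ω, (R ω * Zs ω * Y₁ ω + (1 - R ω * Zs ω) * Y₀ ω) ∂P[|{ω | R ω = 0}] =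
      ∫ ω, Y₀ ω ∂P := by
    rw [← integral_cond_preimage_of_indepFun hR hY₀.aestronglyMeasurable
      hindep_Y₀ (measurableSet_singleton 0) hA0]
    refine integral_congr_ae ?_
    filter_upwards [ae_cond_mem (hR (measurableSet_singleton 0))] with ω hω
    rw [show R ω = 0 from hω]
    ring
  refine ⟨hcondZ, hcondZ ▸ hZs1_pos, ?_, ?_⟩
  · rw [hassigned, hunassigned, hcondZ, integral_add hdiff hY₀, add_sub_cancel_right,
      integral_cond_eq_integral_mul_div P hZs hZs01]
  · have hdiff_cond : ∫ ω, Zs ω * (Y₁ ω - Y₀ ω) ∂P[|{ω | R ω = 1}] =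
        ∫ ω, Zs ω * (Y₁ ω - Y₀ ω) ∂P :=
      integral_cond_preimage_of_indepFun (s := {1}) hR hdiff.aestronglyMeasurable hindep_diff
        (measurableSet_singleton 1) hR1_pos.ne'
    rw [hZset, ← cond_cond_eq_cond_inter hA hB, integral_cond_eq_integral_mul_div P hZs hZs01,
      integral_cond_eq_integral_mul_div _ hZs hZs01, hdiff_cond, hcondZs]
end

section
/- Let (Ω, 𝓕, P) be a probability space carrying random variables Y₁, Y₀ : Ω → ℝ with Y₁ integrable, X : Ω → ℝ^d, and Z : Ω → {0,1}, satisfying E[Z | σ(Y₁, Y₀, X)] = E[Z | σ(Y₀, X)] almost surely. Then E[Y₁ · (1 − Z)] = E[ E[Y₁ | σ(Y₀, X)] · (1 − Z) ]. In particular, if P(Z = 0) > 0 and Y₀ is integrable, then the average treatment effect on the untreated satisfies ATU := E[Y₁ − Y₀ | Z = 0] = E[ E[Y₁ | σ(Y₀, X)] | Z = 0 ] − E[Y₀ | Z = 0]. -/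
open MeasureTheory ProbabilityTheory

/-- The σ-algebra σ(f) generated by a random variable `f`. -/
def sigmaGen {Ω α : Type*} [MeasurableSpace α] (f : Ω → α) : MeasurableSpace Ω :=
  MeasurableSpace.comap f inferInstance

/-- Conditioning one factor on a σ-algebra that makes the other factor measurable
leaves the integral of the product unchanged. -/
theorem integral_mul_condExp_of_stronglyMeasurable {Ω : Type*} {m m₀ : MeasurableSpace Ω}
    {P : Measure Ω} [IsFiniteMeasure P] (hm : m ≤ m₀) {f g : Ω → ℝ}
    (hf : StronglyMeasurable[m] f) (hfg : Integrable (f * g) P) (hg : Integrable g P) :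
    ∫ ω, f ω * (P[g | m]) ω ∂P = ∫ ω, f ω * g ω ∂P :=
  (integral_congr_ae (condExp_mul_of_stronglyMeasurable_left hf hfg hg)).symm.trans
    (integral_condExp hm)

/-- If a bounded variable `Z` has the same conditional expectation given `m` and given a finer
`m'` for which `Y` is measurable, then `Y` may be replaced by `P[Y | m]` in `∫ Y * Z`. -/
theorem integral_condExp_mul_of_condExp_eq {Ω : Type*} {m m' m₀ : MeasurableSpace Ω}
    {P : Measure Ω} [IsFiniteMeasure P] (hm : m ≤ m₀) (hm' : m' ≤ m₀) {Y Z : Ω → ℝ}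
    (hY : StronglyMeasurable[m'] Y) (hYint : Integrable Y P) (hZ : Integrable Z P)
    {c : ℝ} (hc : ∀ᵐ ω ∂P, |Z ω| ≤ c) (h : P[Z | m'] =ᵐ[P] P[Z | m]) :
    ∫ ω, Y ω * Z ω ∂P = ∫ ω, (P[Y | m]) ω * Z ω ∂P := by
  have hbdd : ∀ᵐ ω ∂P, ‖(P[Z | m]) ω‖ ≤ c := ae_bdd_abs_condExp_of_ae_bdd_abs hc
  calc ∫ ω, Y ω * Z ω ∂P = ∫ ω, Y ω * (P[Z | m']) ω ∂P :=
        (integral_mul_condExp_of_stronglyMeasurable hm' hY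
          (hYint.mul_bdd hZ.aestronglyMeasurable hc) hZ).symm
    _ = ∫ ω, Y ω * (P[Z | m]) ω ∂P :=
        integral_congr_ae (h.mono fun ω hω => by simp only [hω])
    _ = ∫ ω, (P[Z | m]) ω * Y ω ∂P := by simp only [mul_comm]
    _ = ∫ ω, (P[Z | m]) ω * (P[Y | m]) ω ∂P :=
        (integral_mul_condExp_of_stronglyMeasurable hm stronglyMeasurable_condExp
          (hYint.bdd_mul integrable_condExp.aestronglyMeasurable hbdd) hYint).symm
    _ = ∫ ω, (P[Y | m]) ω * (P[Z | m]) ω ∂P := by simp only [mul_comm]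
    _ = ∫ ω, (P[Y | m]) ω * Z ω ∂P :=
        integral_mul_condExp_of_stronglyMeasurable hm stronglyMeasurable_condExp
          (integrable_condExp.mul_bdd hZ.aestronglyMeasurable hc) hZ

/-- Identification of ATU under weak ignorability: if
`E[Z | σ(Y₁,Y₀,X)] = E[Z | σ(Y₀,X)]` a.s., then
`E[Y₁ (1−Z)] = E[E[Y₁ | σ(Y₀,X)] (1−Z)]`; in particular, when `P(Z = 0) > 0` and `Y₀` is
integrable, `ATU = E[Y₁ − Y₀ | Z=0] = E[E[Y₁ | σ(Y₀,X)] | Z=0] − E[Y₀ | Z=0]`. -/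
theorem atu_identification_weak_ignorability
    {Ω : Type*} [MeasurableSpace Ω] (P : Measure Ω) [IsProbabilityMeasure P]
    (d : ℕ) (Y₁ Y₀ : Ω → ℝ) (X : Ω → Fin d → ℝ) (Z : Ω → ℝ)
    (hY₁m : Measurable Y₁) (hY₀m : Measurable Y₀) (hX : Measurable X) (hZ : Measurable Z)
    (hZ01 : ∀ ω, Z ω = 0 ∨ Z ω = 1)
    (hY₁int : Integrable Y₁ P)
    (hweak : P[Z | sigmaGen (fun ω => (Y₁ ω, Y₀ ω, X ω))]
      =ᵐ[P] P[Z | sigmaGen (fun ω => (Y₀ ω, X ω))]) :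
    (∫ ω, Y₁ ω * (1 - Z ω) ∂P) =
      (∫ ω, ((P[Y₁ | sigmaGen (fun ω' => (Y₀ ω', X ω'))]) ω) * (1 - Z ω) ∂P) ∧
    (0 < P {ω | Z ω = 0} → Integrable Y₀ P →
      (∫ ω, (Y₁ ω - Y₀ ω) ∂P[|{ω | Z ω = 0}]) =
        (∫ ω, (P[Y₁ | sigmaGen (fun ω' => (Y₀ ω', X ω'))]) ω ∂P[|{ω | Z ω = 0}]) -
          ∫ ω, Y₀ ω ∂P[|{ω | Z ω = 0}]) := by
  have hm : sigmaGen (fun ω => (Y₀ ω, X ω)) ≤ ‹MeasurableSpace Ω› :=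
    (hY₀m.prodMk hX).comap_le
  have hm' : sigmaGen (fun ω => (Y₁ ω, Y₀ ω, X ω)) ≤ ‹MeasurableSpace Ω› :=
    (hY₁m.prodMk (hY₀m.prodMk hX)).comap_le
  have hY₁ : StronglyMeasurable[sigmaGen (fun ω => (Y₁ ω, Y₀ ω, X ω))] Y₁ :=
    (measurable_fst.comp (comap_measurable fun ω => (Y₁ ω, Y₀ ω, X ω))).stronglyMeasurable
  have hbdd : ∀ᵐ ω ∂P, |Z ω| ≤ (1 : ℝ) :=
    .of_forall fun ω => by rcases hZ01 ω with h | h <;> simp [h]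
  have hZint : Integrable Z P := .of_bound hZ.aestronglyMeasurable _ hbdd
  set V := P[Y₁ | sigmaGen (fun ω => (Y₀ ω, X ω))] with hV
  have hVint : Integrable V P := integrable_condExp
  have key : ∫ ω, Y₁ ω * (1 - Z ω) ∂P = ∫ ω, V ω * (1 - Z ω) ∂P := by
    simp only [mul_sub, mul_one]
    rw [integral_sub hY₁int (hY₁int.mul_bdd hZ.aestronglyMeasurable hbdd),
      integral_sub hVint (hVint.mul_bdd hZ.aestronglyMeasurable hbdd),
      integral_condExp_mul_of_condExp_eq hm hm' hY₁ hY₁int hZint hbdd hweak,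
      hV, integral_condExp hm]
  refine ⟨key, fun hpos hY₀int => ?_⟩
  have hs : MeasurableSet {ω | Z ω = 0} := hZ (measurableSet_singleton 0)
  have hcond : ∀ {f : Ω → ℝ}, Integrable f P → Integrable f P[|{ω | Z ω = 0}] := fun hf =>
    hf.restrict.smul_measure (ENNReal.inv_ne_top.2 hpos.ne')
  have hset : ∀ f : Ω → ℝ, ∫ ω in {ω | Z ω = 0}, f ω ∂P = ∫ ω, f ω * (1 - Z ω) ∂P := by
    intro f
    rw [← integral_indicator hs]
    congr 1 with ω
    rcases hZ01 ω with h | h <;> simp [h]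
  rw [integral_sub (hcond hY₁int) (hcond hY₀int)]
  simp only [ProbabilityTheory.cond, integral_smul_measure, hset, key]
end

section
/- Let (Ω, 𝓕, P) be a probability space carrying random variables Y₁, Y₀ : Ω → ℝ, X : Ω → ℝ^d, and Z : Ω → {0,1}, satisfying E[Z | σ(Y₁, Y₀, X)] = E[Z | σ(Y₀, X)] almost surely. Then for every bounded measurable φ : ℝ → ℝ, E[φ(Y₁) · Z | σ(X)] = E[ E[φ(Y₁) | σ(Y₀, X)] · Z | σ(X) ] almost surely. -/
open MeasureTheory

/-- If conditioning `g` on the larger σ-algebra `m₂` gives nothing more than conditioning on `m₁`,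
then a bounded `m₂`-measurable factor `f` may be replaced by its `m₁`-conditional expectation. -/
theorem condExp_mul_ae_eq_condExp_condExp_mul {Ω : Type*} {m₁ m₂ m₀ : MeasurableSpace Ω}
    {μ : Measure Ω} [IsFiniteMeasure μ] (hm₁₂ : m₁ ≤ m₂) (hm₂ : m₂ ≤ m₀) {f g : Ω → ℝ}
    (hf : StronglyMeasurable[m₂] f) (hg : Integrable g μ) {C : ℝ} (hC : ∀ ω, |f ω| ≤ C)
    (h : μ[g | m₂] =ᵐ[μ] μ[g | m₁]) :
    μ[f * g | m₁] =ᵐ[μ] μ[μ[f | m₁] * g | m₁] := by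
  have hf₀ : AEStronglyMeasurable f μ := (hf.mono hm₂).aestronglyMeasurable
  have hfi : Integrable f μ := .of_bound hf₀ C (ae_of_all _ hC)
  have hcond_bound : ∀ᵐ ω ∂μ, |(μ[f | m₁]) ω| ≤ C :=
    ae_bdd_abs_condExp_of_ae_bdd_abs (ae_of_all _ hC)
  calc μ[f * g | m₁]
      =ᵐ[μ] μ[μ[f * g | m₂] | m₁] := (condExp_condExp_of_le hm₁₂ hm₂).symm
    _ =ᵐ[μ] μ[f * μ[g | m₁] | m₁] := condExp_congr_ae <|
        (condExp_stronglyMeasurable_mul_of_bound hm₂ hf hg C (ae_of_all _ hC)).trans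
          (Filter.EventuallyEq.rfl.mul h)
    _ =ᵐ[μ] μ[f | m₁] * μ[g | m₁] :=
        condExp_mul_of_stronglyMeasurable_right stronglyMeasurable_condExp
          (integrable_condExp.bdd_mul hf₀ (ae_of_all _ hC)) hfi
    _ =ᵐ[μ] μ[μ[f | m₁] * g | m₁] :=
        (condExp_stronglyMeasurable_mul_of_bound (hm₁₂.trans hm₂) stronglyMeasurable_condExp hg C
          hcond_bound).symm

/-- Measure-theoretic form of the paper's integral equation (3): under weak ignorability
`E[Z | σ(Y₁,Y₀,X)] = E[Z | σ(Y₀,X)]` a.s., for every bounded measurable `φ`,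
`E[φ(Y₁)·Z | σ(X)] = E[E[φ(Y₁) | σ(Y₀,X)]·Z | σ(X)]` a.s. -/
theorem integral_equation_weak_ignorability
    {Ω : Type*} [MeasurableSpace Ω] (P : Measure Ω) [IsProbabilityMeasure P]
    (d : ℕ) (Y₁ Y₀ : Ω → ℝ) (X : Ω → Fin d → ℝ) (Z : Ω → ℝ)
    (hY₁ : Measurable Y₁) (hY₀ : Measurable Y₀) (hX : Measurable X) (hZ : Measurable Z)
    (hZ01 : ∀ ω, Z ω = 0 ∨ Z ω = 1)
    (hweak : P[Z | sigmaGen (fun ω => (Y₁ ω, Y₀ ω, X ω))]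
      =ᵐ[P] P[Z | sigmaGen (fun ω => (Y₀ ω, X ω))]) :
    ∀ φ : ℝ → ℝ, Measurable φ → (∃ C : ℝ, ∀ y, |φ y| ≤ C) →
      P[fun ω => φ (Y₁ ω) * Z ω | sigmaGen X]
        =ᵐ[P] P[fun ω =>
            ((P[fun ω' => φ (Y₁ ω') | sigmaGen (fun ω' => (Y₀ ω', X ω'))]) ω) * Z ω |
          sigmaGen X] := by
  rintro φ hφ ⟨C, hC⟩
  have hm₂ : sigmaGen (fun ω => (Y₁ ω, Y₀ ω, X ω)) ≤ ‹MeasurableSpace Ω› :=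
    (hY₁.prodMk (hY₀.prodMk hX)).comap_le
  have hm₁₂ : sigmaGen (fun ω => (Y₀ ω, X ω)) ≤ sigmaGen (fun ω => (Y₁ ω, Y₀ ω, X ω)) :=
    (measurable_snd.comp (comap_measurable fun ω => (Y₁ ω, Y₀ ω, X ω))).comap_le
  have hmX : sigmaGen X ≤ sigmaGen (fun ω => (Y₀ ω, X ω)) :=
    (measurable_snd.comp (comap_measurable fun ω => (Y₀ ω, X ω))).comap_le
  have hf : StronglyMeasurable[sigmaGen (fun ω => (Y₁ ω, Y₀ ω, X ω))] fun ω => φ (Y₁ ω) :=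
    ((hφ.comp measurable_fst).comp
      (comap_measurable fun ω => (Y₁ ω, Y₀ ω, X ω))).stronglyMeasurable
  have hZi : Integrable Z P := .of_bound hZ.aestronglyMeasurable 1 <| ae_of_all _ fun ω => by
    rcases hZ01 ω with h | h <;> simp [h]
  have key := condExp_mul_ae_eq_condExp_condExp_mul hm₁₂ hm₂ hf hZi (fun ω => hC (Y₁ ω)) hweak
  exact (condExp_condExp_of_le hmX (hm₁₂.trans hm₂)).symm.trans <|
    (condExp_congr_ae key).trans (condExp_condExp_of_le hmX (hm₁₂.trans hm₂))
end
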